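/- (Comparison of private and public credibility.) For every χ ∈ (0,1) and q₀ ∈ (0,1): if q₀ > (c₂ − c₁)/(l₂ − l₁) then ev*_χ(q₀) > ev^pc_χ(q₀); if q₀ < (c₂ − c₁)/(l₂ − l₁) then ev*_χ(q₀) < ev^pc_χ(q₀); and if q₀ = (c₂ − c₁)/(l₂ − l₁) then ev*_χ(q₀) = ev^pc_χ(q₀). -/

import Mathlib

open scoped Classical

noncomputable section

/-- The credibility threshold χ*(q₀). -/
def chiStarF (c₁ c₂ l₁ l₂ q₀ : ℝ) : ℝ :=
  ((c₂ - c₁) - q₀ * (l₂ - l₁)) / ((1 - q₀) * (c₂ - c₁))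

/-- The expert's equilibrium value ev*_χ(q₀) (private credibility). -/
def evF (c₁ c₂ l₁ l₂ χ q₀ : ℝ) : ℝ :=
  if q₀ ≤ (c₂ - c₁) / (l₂ - l₁) ∧ χ ≤ chiStarF c₁ c₂ l₁ l₂ q₀ then l₁ - c₁
  else ((l₂ - l₁) - χ * (c₂ - c₁)) * q₀ + (l₁ - c₁) - (1 - χ) * (c₂ - c₁)

/-- The prior cutoff q^pc_χ under public credibility. -/
def qPC (c₁ c₂ l₁ l₂ χ : ℝ) : ℝ :=
  (c₂ - c₁) / ((1 - χ) * (l₂ - l₁) + χ * (c₂ - c₁))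

/-- The expert's equilibrium value ev^pc_χ(q₀) under public credibility. -/
def evPC (c₁ c₂ l₁ l₂ χ q₀ : ℝ) : ℝ :=
  if qPC c₁ c₂ l₁ l₂ χ ≤ q₀ then q₀ * l₂ + (1 - q₀) * l₁ - c₂
  else χ * q₀ * (l₂ - c₂) + (1 - χ * q₀) * (l₁ - c₁)

end

/-- The private value off the constant branch exceeds the low-prior public value by
`(1 - χ) * (q₀ * (l₂ - l₁) - (c₂ - c₁))`. -/
lemma private_value_sub_public_low_value (c₁ c₂ l₁ l₂ χ q₀ : ℝ) :
    ((l₂ - l₁) - χ * (c₂ - c₁)) * q₀ + (l₁ - c₁) - (1 - χ) * (c₂ - c₁)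
      - (χ * q₀ * (l₂ - c₂) + (1 - χ * q₀) * (l₁ - c₁))
      = (1 - χ) * (q₀ * (l₂ - l₁) - (c₂ - c₁)) := by
  ring

/-- The public cutoff lies strictly above `(c₂ - c₁) / (l₂ - l₁)`. -/
lemma div_lt_qPC {c₁ c₂ l₁ l₂ χ : ℝ} (hc : c₁ < c₂) (hs : l₁ - c₁ < l₂ - c₂)
    (hχ : χ ∈ Set.Ioo (0 : ℝ) 1) : (c₂ - c₁) / (l₂ - l₁) < qPC c₁ c₂ l₁ l₂ χ := by
  have hC : 0 < c₂ - c₁ := sub_pos.2 hc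
  have hL : 0 < l₂ - l₁ := by linarith
  have hgap : 0 < χ * ((l₂ - l₁) - (c₂ - c₁)) := mul_pos hχ.1 (by linarith)
  have hden : 0 < (1 - χ) * (l₂ - l₁) + χ * (c₂ - c₁) :=
    add_pos (mul_pos (sub_pos.2 hχ.2) hL) (mul_pos hχ.1 hC)
  exact div_lt_div_of_pos_left hC hden (by linarith)

/-- comparison of private and public credibility: for χ, q₀ ∈ (0,1),
ev*_χ(q₀) exceeds, equals, or falls short of ev^pc_χ(q₀) according to whether q₀ exceeds,
equals, or falls short of (c₂ − c₁)/(l₂ − l₁). -/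
theorem private_vs_public_credibility
    (c₁ c₂ l₁ l₂ : ℝ) (hc₁ : 0 ≤ c₁) (hc : c₁ < c₂) (h₁ : c₁ < l₁) (h₂ : c₂ < l₂)
    (hs : l₁ - c₁ < l₂ - c₂)
    (χ q₀ : ℝ) (hχ : χ ∈ Set.Ioo (0:ℝ) 1) (hq₀ : q₀ ∈ Set.Ioo (0:ℝ) 1) :
    ((c₂ - c₁) / (l₂ - l₁) < q₀ →
      evPC c₁ c₂ l₁ l₂ χ q₀ < evF c₁ c₂ l₁ l₂ χ q₀) ∧
    (q₀ < (c₂ - c₁) / (l₂ - l₁) →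
      evF c₁ c₂ l₁ l₂ χ q₀ < evPC c₁ c₂ l₁ l₂ χ q₀) ∧
    (q₀ = (c₂ - c₁) / (l₂ - l₁) →
      evF c₁ c₂ l₁ l₂ χ q₀ = evPC c₁ c₂ l₁ l₂ χ q₀) := by
  have hC : 0 < c₂ - c₁ := sub_pos.2 hc
  have hL : 0 < l₂ - l₁ := by linarith
  have hcut := div_lt_qPC hc hs hχ
  have hdiff := private_value_sub_public_low_value c₁ c₂ l₁ l₂ χ q₀
  have hχ' : 0 < 1 - χ := sub_pos.2 hχ.2
  refine ⟨fun h => ?_, fun h => ?_, fun h => ?_⟩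
  · rw [evF, if_neg fun h' => h.not_ge h'.1, evPC]
    split_ifs
    · have := mul_pos (mul_pos hχ.1 hC) (sub_pos.2 hq₀.2)
      linarith
    · have := mul_pos hχ' (sub_pos.2 ((div_lt_iff₀ hL).1 h))
      linarith
  · rw [evPC, if_neg (h.trans hcut).not_ge, evF]
    split_ifs
    · have := mul_pos (mul_pos hχ.1 hq₀.1) (sub_pos.2 hs)
      linarith
    · have := mul_neg_of_pos_of_neg hχ' (sub_neg.2 ((lt_div_iff₀ hL).1 h))
      linarith
  · have hqL : q₀ * (l₂ - l₁) = c₂ - c₁ := (eq_div_iff hL.ne').1 h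
    have hstar : chiStarF c₁ c₂ l₁ l₂ q₀ = 0 := by rw [chiStarF, hqL, sub_self, zero_div]
    rw [evPC, if_neg (h.trans_lt hcut).not_ge, evF,
      if_neg fun h' => hχ.1.not_ge (hstar ▸ h'.2), ← sub_eq_zero, hdiff, hqL, sub_self, mul_zero]
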